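/- Let X be a real normed linear space of dimension at least 1 (not necessarily separable). Then the hyperspace Fin(X) of nonempty finite subsets of X, with the Hausdorff metric induced by the norm metric, has the compact strong Z-set property: every compact subset of Fin(X) is a strong Z-set in Fin(X). -/

import Mathlib

open Set Metric Filter TopologicalSpace

/-- The hyperspace of nonempty finite subsets of a metric space `X`, equipped with
the Hausdorff metric induced by the metric of `X` (which induces the Vietoris topology). -/
def FinHyp (X : Type*) [MetricSpace X] : Type _ :=
  {A : TopologicalSpace.NonemptyCompacts X // (A : Set X).Finite}

noncomputable instance (X : Type*) [MetricSpace X] : MetricSpace (FinHyp X) :=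
  Subtype.metricSpace

/-- The underlying set of a member of the hyperspace of nonempty finite subsets. -/
def FinHyp.toSet {X : Type*} [MetricSpace X] (A : FinHyp X) : Set X := A.1

/-- A closed subset `A` of a space `Y` is a strong `Z`-set provided that for every open
cover `𝒰` of `Y` there is a continuous map `f : Y → Y` which is `𝒰`-close to the identity
and whose image has closure disjoint from `A`. -/
def IsStrongZSet {Y : Type*} [TopologicalSpace Y] (A : Set Y) : Prop :=
  IsClosed A ∧
    ∀ 𝒰 : Set (Set Y), (∀ U ∈ 𝒰, IsOpen U) → ⋃₀ 𝒰 = Set.univ →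
      ∃ f : Y → Y, Continuous f ∧ (∀ y, ∃ U ∈ 𝒰, y ∈ U ∧ f y ∈ U) ∧
        closure (Set.range f) ∩ A = ∅

theorem FinHyp.finite_toSet {X : Type*} [MetricSpace X] (A : FinHyp X) : A.toSet.Finite := A.2

theorem FinHyp.nonempty_toSet {X : Type*} [MetricSpace X] (A : FinHyp X) : A.toSet.Nonempty :=
  A.1.nonempty

theorem FinHyp.dist_eq {X : Type*} [MetricSpace X] (A B : FinHyp X) :
    dist A B = hausdorffDist A.toSet B.toSet := rfl

theorem FinHyp.ext_toSet {X : Type*} [MetricSpace X] {A B : FinHyp X}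
    (h : A.toSet = B.toSet) : A = B :=
  Subtype.ext (SetLike.coe_injective h)

theorem FinHyp.exists_dist_lt {X : Type*} [MetricSpace X] {A B : FinHyp X} {r : ℝ}
    (h : dist A B < r) {a : X} (ha : a ∈ A.toSet) : ∃ b ∈ B.toSet, dist a b < r :=
  exists_dist_lt_of_hausdorffDist_lt ha h
    (hausdorffEDist_ne_top_of_nonempty_of_bounded A.nonempty_toSet B.nonempty_toSet
      A.finite_toSet.isBounded B.finite_toSet.isBounded)

/-- The finite set `{a + (s * t) • v | a ∈ A, t ∈ T}`. -/
noncomputable def FinHyp.smear {X : Type*} [NormedAddCommGroup X] [NormedSpace ℝ X]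
    (T : Finset ℝ) (hT : T.Nonempty) (v : X) (s : ℝ) (A : FinHyp X) : FinHyp X :=
  ⟨⟨⟨Set.image2 (fun a t => a + (s * t) • v) A.toSet T,
    (A.finite_toSet.image2 _ T.finite_toSet).isCompact⟩, A.nonempty_toSet.image2 hT⟩,
    A.finite_toSet.image2 _ T.finite_toSet⟩

section Smear

variable {X : Type*} [NormedAddCommGroup X] [NormedSpace ℝ X]

theorem FinHyp.toSet_smear (T : Finset ℝ) (hT : T.Nonempty) (v : X) (s : ℝ) (A : FinHyp X) :
    (A.smear T hT v s).toSet = Set.image2 (fun a t => a + (s * t) • v) A.toSet T := rfl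

theorem FinHyp.smear_zero (T : Finset ℝ) (hT : T.Nonempty) (v : X) (A : FinHyp X) :
    A.smear T hT v 0 = A := by
  refine FinHyp.ext_toSet ?_
  rw [FinHyp.toSet_smear]
  ext x
  obtain ⟨t, ht⟩ := hT
  simp only [Set.mem_image2, zero_mul, zero_smul, add_zero]
  exact ⟨fun ⟨a, ha, _, _, h⟩ => h ▸ ha, fun hx => ⟨x, hx, t, ht, rfl⟩⟩

theorem FinHyp.dist_smear_le {T : Finset ℝ} (hT : T.Nonempty) (hT1 : ∀ t ∈ T, |t| ≤ 1) {v : X}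
    (hv : ‖v‖ = 1) (s s' : ℝ) (A B : FinHyp X) :
    dist (A.smear T hT v s) (B.smear T hT v s') ≤ dist A B + |s - s'| := by
  have shift (a b : X) (s s' t : ℝ) (ht : t ∈ T) :
      dist (a + (s * t) • v) (b + (s' * t) • v) ≤ dist a b + |s - s'| := by
    refine (dist_add_add_le _ _ _ _).trans ?_
    gcongr
    rw [dist_eq_norm, ← sub_smul, ← sub_mul, norm_smul, hv, mul_one, norm_mul, Real.norm_eq_abs,
      Real.norm_eq_abs]
    exact mul_le_of_le_one_right (abs_nonneg _) (hT1 t ht)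
  refine le_of_forall_gt_imp_ge_of_dense fun r hr => ?_
  have hr' : dist A B < r - |s - s'| := by linarith
  have half (A B : FinHyp X) (s s' : ℝ) (hr' : dist A B < r - |s - s'|) :
      ∀ x ∈ (A.smear T hT v s).toSet, ∃ y ∈ (B.smear T hT v s').toSet, dist x y ≤ r := by
    rintro _ ⟨a, ha, t, ht, rfl⟩
    obtain ⟨b, hb, hab⟩ := FinHyp.exists_dist_lt hr' ha
    exact ⟨_, ⟨b, hb, t, ht, rfl⟩, (shift a b s s' t ht).trans (by linarith)⟩
  refine hausdorffDist_le_of_mem_dist ?_ (half A B s s' hr') (half B A s' s ?_)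
  · linarith [dist_nonneg (x := A) (y := B), abs_nonneg (s - s')]
  · rwa [dist_comm, abs_sub_comm]

theorem FinHyp.dist_smear_self_le {T : Finset ℝ} (hT : T.Nonempty) (hT1 : ∀ t ∈ T, |t| ≤ 1)
    {v : X} (hv : ‖v‖ = 1) (s : ℝ) (A : FinHyp X) : dist (A.smear T hT v s) A ≤ |s| := by
  simpa [FinHyp.smear_zero] using FinHyp.dist_smear_le hT hT1 hv s 0 A A

theorem FinHyp.continuous_smear {T : Finset ℝ} (hT : T.Nonempty) (hT1 : ∀ t ∈ T, |t| ≤ 1)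
    {v : X} (hv : ‖v‖ = 1) {g : FinHyp X → ℝ} (hg : Continuous g) :
    Continuous fun A : FinHyp X => A.smear T hT v (g A) := by
  refine continuous_iff_continuousAt.2 fun A => tendsto_iff_dist_tendsto_zero.2 ?_
  refine squeeze_zero (fun _ => dist_nonneg)
    (fun B => FinHyp.dist_smear_le hT hT1 hv (g B) (g A) B A) ?_
  have : Continuous fun B => dist B A + |g B - g A| := by fun_prop
  simpa using this.tendsto A

/-- Smearing a set by sufficiently many points of a segment keeps it away from
a given finite set. -/
theorem FinHyp.exists_smear_notMem_ball {v : X} (hv : ‖v‖ = 1) {δ : ℝ} (hδ : 0 < δ)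
    (C : FinHyp X) : ∃ T : Finset ℝ, (∀ t ∈ T, |t| ≤ 1) ∧ ∃ η > 0,
      ∀ (S : Finset ℝ) (hS : S.Nonempty) (A : FinHyp X), T ⊆ S →
        A.smear S hS v δ ∉ ball C η := by
  set N := C.finite_toSet.toFinset.card with hN
  have hNpos : (0 : ℝ) < N := by
    have : 0 < N := Finset.card_pos.2 (C.finite_toSet.toFinset_nonempty.2 C.nonempty_toSet)
    exact_mod_cast this
  refine ⟨(Finset.range (N + 1)).image fun i : ℕ => (i : ℝ) / N, ?_, δ / (2 * N), by positivity,
    fun S hS A hTS hmem => ?_⟩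
  · simp only [Finset.mem_image, Finset.mem_range]
    rintro _ ⟨i, hi, rfl⟩
    rw [abs_of_nonneg (by positivity), div_le_one hNpos]
    exact_mod_cast Nat.lt_succ_iff.1 hi
  · obtain ⟨a, ha⟩ := A.nonempty_toSet
    have near (i : ℕ) (hi : i ∈ Finset.range (N + 1)) : ∃ c ∈ C.toSet,
        dist (a + (δ * ((i : ℝ) / N)) • v) c < δ / (2 * N) :=
      FinHyp.exists_dist_lt hmem ⟨a, ha, _, hTS (Finset.mem_image_of_mem _ hi), rfl⟩
    choose! φ hφ hdist using near
    obtain ⟨i, hi, j, hj, hij, heq⟩ := Finset.exists_ne_map_eq_of_card_lt_of_maps_to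
      (s := Finset.range (N + 1)) (t := C.finite_toSet.toFinset) (f := φ)
      (by rw [Finset.card_range]; omega)
      (fun i hi => C.finite_toSet.mem_toFinset.2 (hφ i hi))
    have h1 := hdist i hi
    have h2 := hdist j hj
    rw [← heq] at h2
    have h3 := dist_triangle_right (a + (δ * ((i : ℝ) / N)) • v) (a + (δ * ((j : ℝ) / N)) • v)
      (φ i)
    have h4 : dist (a + (δ * ((i : ℝ) / N)) • v) (a + (δ * ((j : ℝ) / N)) • v)
        = δ / N * |(i : ℝ) - j| := by
      rw [dist_add_left, dist_eq_norm, ← sub_smul, norm_smul, hv, mul_one, Real.norm_eq_abs,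
        show δ * ((i : ℝ) / N) - δ * ((j : ℝ) / N) = δ / N * (i - j) by ring, abs_mul,
        abs_of_pos (by positivity)]
    have h5 : (1 : ℝ) ≤ |(i : ℝ) - j| := by
      have : (1 : ℤ) ≤ |(i : ℤ) - j| := Int.one_le_abs (by omega)
      exact_mod_cast this
    have h6 : δ / N * 1 ≤ δ / N * |(i : ℝ) - j| := by gcongr
    have h7 : δ / (2 * N) + δ / (2 * N) = δ / N := by field_simp; norm_num
    linarith

/-- For a compact family one finite set of parameters avoids a whole neighbourhood. -/
theorem FinHyp.exists_smear_notMem_isOpen {v : X} (hv : ‖v‖ = 1) {δ : ℝ} (hδ : 0 < δ)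
    {C : Set (FinHyp X)} (hC : IsCompact C) :
    ∃ T : Finset ℝ, ∃ hT : T.Nonempty, (∀ t ∈ T, |t| ≤ 1) ∧
      ∃ W : Set (FinHyp X), IsOpen W ∧ C ⊆ W ∧ ∀ A : FinHyp X, A.smear T hT v δ ∉ W := by
  choose T hT1 η hη havoid using fun c : FinHyp X => FinHyp.exists_smear_notMem_ball hv hδ c
  obtain ⟨F, -, hF⟩ := hC.elim_nhds_subcover (fun c => ball c (η c))
    (fun c _ => ball_mem_nhds c (hη c))
  classical
  refine ⟨insert 0 (F.biUnion T), Finset.insert_nonempty _ _, ?_, _,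
    isOpen_biUnion fun _ _ => isOpen_ball, hF, fun A hA => ?_⟩
  · intro t ht
    rcases Finset.mem_insert.1 ht with rfl | ht
    · simp
    · obtain ⟨c, -, hc⟩ := Finset.mem_biUnion.1 ht
      exact hT1 c t hc
  · obtain ⟨c, hcF, hc⟩ := Set.mem_iUnion₂.1 hA
    exact havoid c _ _ A
      ((Finset.subset_biUnion_of_mem T hcF).trans (Finset.subset_insert _ _)) hc

end Smear

/-- Every open cover of a metric space admits a continuous radius function whose closed balls
refine the cover. -/
theorem exists_continuous_closedBall_subset_cover {Y : Type*} [MetricSpace Y] {𝒰 : Set (Set Y)}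
    (ho : ∀ U ∈ 𝒰, IsOpen U) (hc : ⋃₀ 𝒰 = Set.univ) :
    ∃ ε : C(Y, ℝ), ∀ y, 0 < ε y ∧ ∃ U ∈ 𝒰, closedBall y (ε y) ⊆ U := by
  refine exists_continuous_forall_mem_convex_of_local_const
    (t := fun y => {r : ℝ | 0 < r ∧ ∃ U ∈ 𝒰, closedBall y r ⊆ U}) (fun y => ?_) (fun y => ?_)
  · refine Set.OrdConnected.convex ⟨?_⟩
    rintro r ⟨hr, -⟩ s ⟨-, U, hU, hs⟩ q ⟨hq, hq'⟩
    exact ⟨hr.trans_le hq, U, hU, (closedBall_subset_closedBall hq').trans hs⟩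
  · obtain ⟨U, hU, hy⟩ := Set.mem_sUnion.1 (hc ▸ Set.mem_univ y)
    obtain ⟨r, hr, hrU⟩ := Metric.isOpen_iff.1 (ho U hU) y hy
    refine ⟨r / 2, Filter.mem_of_superset (ball_mem_nhds y (half_pos hr)) fun z hz =>
      ⟨half_pos hr, U, hU, (closedBall_subset_ball' ?_).trans hrU⟩⟩
    rw [mem_ball] at hz
    linarith

/-- (Yaguchi) If `X` is a real normed linear space of dimension at least `1`
(i.e. a nontrivial real normed space, not necessarily separable), then the hyperspace
`Fin(X)` of nonempty finite subsets with the Hausdorff metric induced by the norm metric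
has the compact strong `Z`-set property: every compact subset is a strong `Z`-set. -/
theorem finHyp_compact_strongZSet_property_of_normedSpace (X : Type*)
    [NormedAddCommGroup X] [NormedSpace ℝ X] [Nontrivial X] :
    ∀ C : Set (FinHyp X), IsCompact C → IsStrongZSet C := by
  intro C hC
  refine ⟨hC.isClosed, fun 𝒰 ho hc => ?_⟩
  obtain ⟨v, hv⟩ := exists_norm_eq X zero_le_one
  obtain ⟨ε, hε⟩ := exists_continuous_closedBall_subset_cover ho hc
  obtain ⟨r, hr, hrC⟩ := hC.exists_forall_le' ε.continuous.continuousOn (fun A _ => (hε A).1)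
  obtain ⟨q, hq, hqC⟩ := hC.exists_thickening_subset_open
    (isOpen_lt continuous_const ε.continuous : IsOpen {A | r / 2 < ε A})
    (fun A hA => (half_lt_self hr).trans_le (hrC A hA))
  obtain ⟨δ, hδ, hδr, hδq⟩ : ∃ δ > 0, δ ≤ r / 2 ∧ δ ≤ q / 2 :=
    ⟨min (r / 2) (q / 2), lt_min (half_pos hr) (half_pos hq), min_le_left _ _, min_le_right _ _⟩
  obtain ⟨T, hT, hT1, W, hWo, hCW, hW⟩ := FinHyp.exists_smear_notMem_isOpen hv hδ hC
  have hpos (A : FinHyp X) : 0 < min (ε A) δ := lt_min (hε A).1 hδ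
  have hdist (A : FinHyp X) : dist (A.smear T hT v (min (ε A) δ)) A ≤ min (ε A) δ := by
    simpa [abs_of_pos (hpos A)] using FinHyp.dist_smear_self_le hT hT1 hv (min (ε A) δ) A
  refine ⟨fun A => A.smear T hT v (min (ε A) δ),
    FinHyp.continuous_smear hT hT1 hv (ε.continuous.min continuous_const), fun A => ?_, ?_⟩
  · obtain ⟨U, hU, hsub⟩ := (hε A).2
    exact ⟨U, hU, hsub (mem_closedBall_self (hε A).1.le),
      hsub (mem_closedBall.2 ((hdist A).trans (min_le_left _ _)))⟩
  · have hdisj : Disjoint (W ∩ thickening δ C)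
        (Set.range fun A : FinHyp X => A.smear T hT v (min (ε A) δ)) := by
      rw [Set.disjoint_right]
      rintro _ ⟨A, rfl⟩ ⟨hAW, hAC⟩
      obtain ⟨c, hcC, hc⟩ := mem_thickening_iff.1 hAC
      have hA : A ∈ thickening q C := by
        refine mem_thickening_iff.2 ⟨c, hcC, ?_⟩
        have h1 := dist_triangle_left A c (A.smear T hT v (min (ε A) δ))
        have h2 := (hdist A).trans (min_le_right _ _)
        linarith
      have hεA : r / 2 < ε A := hqC hA
      simp only [min_eq_right (hδr.trans hεA.le)] at hAW
      exact hW A hAW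
    have hdisj' := hdisj.closure_right (hWo.inter isOpen_thickening)
    exact (hdisj'.symm.mono_right
      (Set.subset_inter hCW (self_subset_thickening hδ C))).inter_eq
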